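/- arXiv:1402.0482 — 4 statements merged into one kernel-verified Lean document; each statement's English description precedes it below -/
import Mathlib

section
/- Every homomorphism from G = ⟨x, y, z | x²y²z² = 1⟩ to a free group has abelian image. -/
def surfaceRels : Set (FreeGroup (Fin 3)) :=
  {FreeGroup.of 0 ^ 2 * FreeGroup.of 1 ^ 2 * FreeGroup.of 2 ^ 2}

abbrev SurfaceGroup : Type := PresentedGroup surfaceRels

/-- The abelianization of a free group has no 2-torsion. -/
theorem FreeGroup.mem_commutator_of_sq_mem {X : Type*} {w : FreeGroup X}
    (hw : w ^ 2 ∈ commutator (FreeGroup X)) : w ∈ commutator (FreeGroup X) := by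
  rw [← Abelianization.ker_of, MonoidHom.mem_ker] at hw ⊢
  let e : FreeAbelianGroup X ≃+ (X →₀ ℤ) := FreeAbelianGroup.equivFinsupp X
  let v : FreeAbelianGroup X := Additive.ofMul (Abelianization.of w)
  have hv : 2 • v = 0 := by
    rw [map_pow] at hw
    exact hw
  have he : 2 • e v = 0 := by rw [← map_nsmul, hv, map_zero]
  have hv0 : v = 0 := by simpa using he
  exact hv0

/-- A homomorphism whose values on a generating set commute has commuting values everywhere. -/
theorem MonoidHom.commute_of_closure_eq_top {G M : Type*} [Group G] [Group M] (f : G →* M)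
    {s : Set G} (hs : Subgroup.closure s = ⊤)
    (hf : ∀ x ∈ s, ∀ y ∈ s, Commute (f x) (f y)) (g h : G) : Commute (f g) (f h) := by
  have hg : g ∈ Subgroup.closure s := hs ▸ Subgroup.mem_top g
  have hh : h ∈ Subgroup.closure s := hs ▸ Subgroup.mem_top h
  induction hg, hh using Subgroup.closure_induction₂ with
  | mem x y hx hy => exact hf x hx y hy
  | one_left x hx => rw [map_one]; exact Commute.one_left _
  | one_right x hx => rw [map_one]; exact Commute.one_right _
  | mul_left x y z _ _ _ h₁ h₂ => rw [map_mul]; exact h₁.mul_left h₂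
  | mul_right y z x _ _ _ h₁ h₂ => rw [map_mul]; exact h₁.mul_right h₂
  | inv_left x y _ _ h => rw [map_inv]; exact h.inv_left
  | inv_right x y _ _ h => rw [map_inv]; exact h.inv_right

open scoped commutatorElement in
theorem DihedralGroup.commutator_four_le :
    commutator (DihedralGroup 4) ≤ Subgroup.zpowers (DihedralGroup.r 2) := by
  rw [commutator_def, Subgroup.commutator_le]
  have key : ∀ x y : DihedralGroup 4, ⁅x, y⁆ = r 2 ^ 0 ∨ ⁅x, y⁆ = r 2 ^ 1 := by
    simp only [commutatorElement_def]
    decide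
  intro x _ y _
  rcases key x y with h | h <;> rw [h] <;> exact Subgroup.npow_mem_zpowers _ _

theorem DihedralGroup.eq_of_mem_commutator_four {w : DihedralGroup 4}
    (hw : w ∈ commutator (DihedralGroup 4)) : w = 1 ∨ w = r 2 := by
  obtain ⟨k, rfl⟩ := Subgroup.mem_zpowers_iff.mp (commutator_four_le hw)
  have h2 : (r 2 : DihedralGroup 4) ^ (2 : ℤ) = 1 := by decide
  obtain ⟨m, rfl | rfl⟩ := Int.even_or_odd' k
  · left; rw [zpow_mul, h2, one_zpow]
  · right; rw [zpow_add, zpow_mul, h2, one_zpow, one_mul, zpow_one]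

theorem DihedralGroup.commute_of_sq_mul_sq_mul_sq {x y z : DihedralGroup 4}
    (h : x ^ 2 * y ^ 2 * z ^ 2 = 1) (hD : x * y * z ∈ commutator (DihedralGroup 4)) :
    x * y = y * x ∧ x * z = z * x ∧ y * z = z * y := by
  obtain ⟨w, hxyz, hw⟩ : ∃ w, x * y * z = w ∧ (w = 1 ∨ w = r 2) :=
    ⟨_, rfl, eq_of_mem_commutator_four hD⟩
  obtain rfl : z = (x * y)⁻¹ * w := by rw [← hxyz]; group
  clear hxyz hD
  rcases hw with rfl | rfl <;> revert x y <;> decide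

namespace SurfaceGroup

theorem relation_map {M : Type*} [Group M] (f : SurfaceGroup →* M) :
    f (PresentedGroup.of 0) ^ 2 * f (PresentedGroup.of 1) ^ 2 *
      f (PresentedGroup.of 2) ^ 2 = 1 := by
  have h : PresentedGroup.mk surfaceRels
      (FreeGroup.of 0 ^ 2 * FreeGroup.of 1 ^ 2 * FreeGroup.of 2 ^ 2) = 1 :=
    PresentedGroup.one_of_mem rfl
  simp only [PresentedGroup.of, ← map_mul, ← map_pow, h, map_one]

theorem commute_map_dihedralGroup {X : Type*} (ψ : SurfaceGroup →* FreeGroup X)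
    (f : FreeGroup X →* DihedralGroup 4) (g h : SurfaceGroup) :
    Commute (f (ψ g)) (f (ψ h)) := by
  set a := ψ (PresentedGroup.of 0)
  set b := ψ (PresentedGroup.of 1)
  set c := ψ (PresentedGroup.of 2)
  have habc : a * b * c ∈ commutator (FreeGroup X) := by
    apply FreeGroup.mem_commutator_of_sq_mem
    have hrel := congrArg Abelianization.of (relation_map ψ)
    rw [← Abelianization.ker_of, MonoidHom.mem_ker]
    simpa only [map_mul, map_pow, map_one, mul_pow] using hrel
  have hD : f (a * b * c) ∈ commutator (DihedralGroup 4) := by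
    have := Subgroup.mem_map_of_mem f habc
    rw [commutator_def, Subgroup.map_commutator] at this
    exact Subgroup.commutator_mono le_top le_top this
  rw [map_mul, map_mul] at hD
  obtain ⟨hab, hac, hbc⟩ :=
    DihedralGroup.commute_of_sq_mul_sq_mul_sq (relation_map (f.comp ψ)) hD
  refine (f.comp ψ).commute_of_closure_eq_top (PresentedGroup.closure_range_of surfaceRels) ?_ g h
  rintro _ ⟨i, rfl⟩ _ ⟨j, rfl⟩
  fin_cases i <;> fin_cases j
  exacts [Commute.refl _, hab, hac, hab.symm, Commute.refl _, hbc, hac.symm, hbc.symm,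
    Commute.refl _]

/-- Free quotients of the surface group have rank at most one. -/
theorem subsingleton_of_surjective {X : Type*} (ψ : SurfaceGroup →* FreeGroup X)
    (hψ : Function.Surjective ψ) : Subsingleton X := by
  classical
  refine ⟨fun i j => by_contra fun hij => ?_⟩
  obtain ⟨g, hg⟩ := hψ (FreeGroup.of i)
  obtain ⟨h, hh⟩ := hψ (FreeGroup.of j)
  have hcomm := commute_map_dihedralGroup ψ
    (FreeGroup.lift fun k => if k = i then DihedralGroup.r 1 else DihedralGroup.sr 0) g h
  rw [hg, hh, FreeGroup.lift_apply_of, FreeGroup.lift_apply_of, if_pos rfl,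
    if_neg (Ne.symm hij)] at hcomm
  exact absurd hcomm.eq (by decide)

end SurfaceGroup

/-- Every homomorphism from `G = ⟨x, y, z ∣ x²y²z² = 1⟩` to a free group has
abelian image. -/
theorem surfaceGroup_hom_to_free_abelian_image {β : Type*}
    (φ : SurfaceGroup →* FreeGroup β) :
    ∀ g h : SurfaceGroup, Commute (φ g) (φ h) := by
  intro g h
  let e := IsFreeGroup.toFreeGroup φ.range
  have := SurfaceGroup.subsingleton_of_surjective (e.toMonoidHom.comp φ.rangeRestrict)
    (e.surjective.comp φ.rangeRestrict_surjective)
  have hcomm : Commute (e (φ.rangeRestrict g)) (e (φ.rangeRestrict h)) := by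
    refine (MonoidHom.id _).commute_of_closure_eq_top (FreeGroup.closure_range_of _) ?_ _ _
    rintro _ ⟨i, rfl⟩ _ ⟨j, rfl⟩
    rw [Subsingleton.elim i j]
    exact Commute.refl _
  exact (hcomm.of_map e.injective).map φ.range.subtype
end

section
/- In a free group, if all solutions of a one-variable-per-generator equation force commutativity—specifically, if a, b, c are elements of a free group F with a²b²c² = 1—then a, b, c lie in a common cyclic subgroup of F. -/
/-- The Heisenberg group over `R`: the triple `(x, y, z)` stands for the upper unitriangular
matrix with superdiagonal `(x, y)` and corner `z`. -/
@[ext]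
structure HeisenbergGroup (R : Type*) where
  x : R
  y : R
  z : R

namespace HeisenbergGroup

variable {R : Type*} [CommRing R]

instance : Mul (HeisenbergGroup R) := ⟨fun g h => ⟨g.x + h.x, g.y + h.y, g.z + h.z + g.x * h.y⟩⟩
instance : One (HeisenbergGroup R) := ⟨⟨0, 0, 0⟩⟩
instance : Inv (HeisenbergGroup R) := ⟨fun g => ⟨-g.x, -g.y, -g.z + g.x * g.y⟩⟩

@[simp] lemma mul_x (g h : HeisenbergGroup R) : (g * h).x = g.x + h.x := rfl
@[simp] lemma mul_y (g h : HeisenbergGroup R) : (g * h).y = g.y + h.y := rfl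
@[simp] lemma mul_z (g h : HeisenbergGroup R) : (g * h).z = g.z + h.z + g.x * h.y := rfl
@[simp] lemma one_x : (1 : HeisenbergGroup R).x = 0 := rfl
@[simp] lemma one_y : (1 : HeisenbergGroup R).y = 0 := rfl
@[simp] lemma one_z : (1 : HeisenbergGroup R).z = 0 := rfl
@[simp] lemma inv_x (g : HeisenbergGroup R) : g⁻¹.x = -g.x := rfl
@[simp] lemma inv_y (g : HeisenbergGroup R) : g⁻¹.y = -g.y := rfl
@[simp] lemma inv_z (g : HeisenbergGroup R) : g⁻¹.z = -g.z + g.x * g.y := rfl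

instance : Group (HeisenbergGroup R) :=
  Group.ofLeftAxioms (fun a b c => by ext <;> simp <;> ring) (fun a => by ext <;> simp)
    (fun a => by ext <;> simp)

/-- The determinant of the images of two elements in the abelianization `R × R`. -/
def det (g h : HeisenbergGroup R) : R := g.x * h.y - h.x * g.y

variable {a b c : HeisenbergGroup ℤ}

lemma x_add_x_add_x_eq_zero (h : a ^ 2 * b ^ 2 * c ^ 2 = 1) : a.x + b.x + c.x = 0 := by
  have := congrArg x h
  simp only [pow_two, mul_x, one_x] at this
  linarith

lemma y_add_y_add_y_eq_zero (h : a ^ 2 * b ^ 2 * c ^ 2 = 1) : a.y + b.y + c.y = 0 := by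
  have := congrArg y h
  simp only [pow_two, mul_y, one_y] at this
  linarith

lemma two_dvd_det (h : a ^ 2 * b ^ 2 * c ^ 2 = 1) : 2 ∣ det a b := by
  have hx : c.x = -(a.x + b.x) := by linarith [x_add_x_add_x_eq_zero h]
  have hy : c.y = -(a.y + b.y) := by linarith [y_add_y_add_y_eq_zero h]
  have hz := congrArg z h
  simp only [pow_two, mul_z, mul_x, mul_y, one_z, hx, hy] at hz
  refine ⟨-(a.z + b.z + c.z + a.x * a.y + b.x * b.y + 2 * a.x * b.y
    - 2 * (a.x + b.x) * (a.y + b.y)) - b.x * a.y, ?_⟩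
  unfold det
  linarith

lemma exists_eq_combination_of_mem_closure (h : a ^ 2 * b ^ 2 * c ^ 2 = 1)
    {g : HeisenbergGroup ℤ} (hg : g ∈ Subgroup.closure {a, b, c}) :
    ∃ m n : ℤ, g.x = m * a.x + n * b.x ∧ g.y = m * a.y + n * b.y := by
  have hx := x_add_x_add_x_eq_zero h
  have hy := y_add_y_add_y_eq_zero h
  induction hg using Subgroup.closure_induction with
  | mem g hg =>
    rcases hg with rfl | rfl | rfl
    · exact ⟨1, 0, by ring, by ring⟩
    · exact ⟨0, 1, by ring, by ring⟩
    · exact ⟨-1, -1, by linarith, by linarith⟩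
  | one => exact ⟨0, 0, by simp, by simp⟩
  | mul g k _ _ ihg ihk =>
    obtain ⟨m, n, h₁, h₂⟩ := ihg
    obtain ⟨m', n', h₃, h₄⟩ := ihk
    exact ⟨m + m', n + n', by rw [mul_x, h₁, h₃]; ring, by rw [mul_y, h₂, h₄]; ring⟩
  | inv g _ ih =>
    obtain ⟨m, n, h₁, h₂⟩ := ih
    exact ⟨-m, -n, by rw [inv_x, h₁]; ring, by rw [inv_y, h₂]; ring⟩

lemma two_dvd_det_of_mem_closure (h : a ^ 2 * b ^ 2 * c ^ 2 = 1) {g k : HeisenbergGroup ℤ}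
    (hg : g ∈ Subgroup.closure {a, b, c}) (hk : k ∈ Subgroup.closure {a, b, c}) :
    2 ∣ det g k := by
  obtain ⟨m, n, h₁, h₂⟩ := exists_eq_combination_of_mem_closure h hg
  obtain ⟨m', n', h₃, h₄⟩ := exists_eq_combination_of_mem_closure h hk
  have : det g k = det a b * (m * n' - n * m') := by
    rw [det, det, h₁, h₂, h₃, h₄]; ring
  exact this ▸ (two_dvd_det h).mul_right _

end HeisenbergGroup

namespace IsFreeGroup

variable {G : Type*} [Group G] [IsFreeGroup G]

lemma isCyclic_of_subsingleton_generators [Subsingleton (Generators G)] : IsCyclic G := by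
  refine isCyclic_of_surjective (mulEquiv G) (mulEquiv G).surjective (hH := ?_)
  rcases isEmpty_or_nonempty (Generators G) with _ | ⟨⟨i⟩⟩
  · infer_instance
  · refine ⟨FreeGroup.of i, fun g => ?_⟩
    have hle : Subgroup.closure (Set.range FreeGroup.of) ≤ Subgroup.zpowers (FreeGroup.of i) := by
      rw [Subgroup.closure_le]
      rintro _ ⟨j, rfl⟩
      rw [Subsingleton.elim j i]
      exact Subgroup.mem_zpowers _
    exact hle (FreeGroup.closure_range_of (Generators G) ▸ Subgroup.mem_top g)

/-- A free group generated by `a, b, c` with `a²b²c² = 1` is cyclic: were its rank at least two,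
two basis elements could be sent to elements of the integral Heisenberg group with odd
determinant. -/
theorem isCyclic_of_sq_mul_sq_mul_sq_eq_one {a b c : G} (h : a ^ 2 * b ^ 2 * c ^ 2 = 1)
    (hgen : Subgroup.closure {a, b, c} = ⊤) : IsCyclic G := by
  classical
  have : Subsingleton (Generators G) := by
    refine ⟨fun i j => ?_⟩
    by_contra hij
    let f : G →* HeisenbergGroup ℤ :=
      lift fun k => if k = i then ⟨1, 0, 0⟩ else if k = j then ⟨0, 1, 0⟩ else 1
    have hrel : f a ^ 2 * f b ^ 2 * f c ^ 2 = 1 := by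
      simpa only [map_mul, map_pow, map_one] using congrArg f h
    have hmem (g : G) : f g ∈ Subgroup.closure {f a, f b, f c} := by
      have := Subgroup.mem_map_of_mem f (hgen ▸ Subgroup.mem_top g)
      rwa [MonoidHom.map_closure, Set.image_insert_eq, Set.image_pair] at this
    have hdvd := HeisenbergGroup.two_dvd_det_of_mem_closure hrel (hmem (of i)) (hmem (of j))
    simp [f, HeisenbergGroup.det, Ne.symm hij] at hdvd
  exact isCyclic_of_subsingleton_generators

end IsFreeGroup

/-- In a free group, elements `a, b, c` with `a²b²c² = 1` lie in a common cyclic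
subgroup. -/
theorem sq_sq_sq_mem_common_cyclic {α : Type*} (a b c : FreeGroup α)
    (h : a ^ 2 * b ^ 2 * c ^ 2 = 1) :
    ∃ d : FreeGroup α, a ∈ Subgroup.zpowers d ∧ b ∈ Subgroup.zpowers d ∧
      c ∈ Subgroup.zpowers d := by
  let H : Subgroup (FreeGroup α) := Subgroup.closure {a, b, c}
  have ha : a ∈ H := Subgroup.subset_closure (by simp)
  have hb : b ∈ H := Subgroup.subset_closure (by simp)
  have hc : c ∈ H := Subgroup.subset_closure (by simp)
  have hgen : Subgroup.closure {(⟨a, ha⟩ : H), ⟨b, hb⟩, ⟨c, hc⟩} = ⊤ := by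
    apply Subgroup.map_injective H.subtype_injective
    rw [MonoidHom.map_closure, Set.image_insert_eq, Set.image_pair, ← MonoidHom.range_eq_map,
      Subgroup.range_subtype]
    rfl
  have : IsCyclic H :=
    IsFreeGroup.isCyclic_of_sq_mul_sq_mul_sq_eq_one (Subtype.ext h) hgen
  obtain ⟨d, hd⟩ := this.exists_generator
  have hmem {g : FreeGroup α} (hg : g ∈ H) : g ∈ Subgroup.zpowers (d : FreeGroup α) := by
    obtain ⟨n, hn⟩ := hd ⟨g, hg⟩
    exact ⟨n, congrArg Subtype.val hn⟩
  exact ⟨d, hmem ha, hmem hb, hmem hc⟩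
end

section
/- In a free group F, if u₁, u₂, u₃, a are elements with u₁⁻¹ a u₁ · u₂⁻¹ a u₂ · u₃⁻¹ a u₃ = a³ and a ≠ 1, then u₁⁻¹ a u₁, u₂⁻¹ a u₂, u₃⁻¹ a u₃ all equal... pairwise commute with a; in particular each conjugate u_i⁻¹ a u_i commutes with a. -/
open Quaternion Polynomial Filter Topology

/-- The Hadamard inequality for a `3 × 3` determinant. -/
theorem det_sq_le_mul_mul (x₁ x₂ x₃ p₁ p₂ p₃ q₁ q₂ q₃ : ℝ) :
    (x₁ * (p₂ * q₃ - p₃ * q₂) + x₂ * (p₃ * q₁ - p₁ * q₃) + x₃ * (p₁ * q₂ - p₂ * q₁)) ^ 2 ≤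
      (x₁ ^ 2 + x₂ ^ 2 + x₃ ^ 2) *
        ((p₁ ^ 2 + p₂ ^ 2 + p₃ ^ 2) * (q₁ ^ 2 + q₂ ^ 2 + q₃ ^ 2)) := by
  have cauchy : ∀ n₁ n₂ n₃ : ℝ, (x₁ * n₁ + x₂ * n₂ + x₃ * n₃) ^ 2 ≤
      (x₁ ^ 2 + x₂ ^ 2 + x₃ ^ 2) * (n₁ ^ 2 + n₂ ^ 2 + n₃ ^ 2) := fun n₁ n₂ n₃ ↦ by
    linarith [sq_nonneg (x₁ * n₂ - x₂ * n₁), sq_nonneg (x₁ * n₃ - x₃ * n₁),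
      sq_nonneg (x₂ * n₃ - x₃ * n₂)]
  refine (cauchy _ _ _).trans (mul_le_mul_of_nonneg_left ?_ (by positivity))
  linarith [sq_nonneg (p₁ * q₁ + p₂ * q₂ + p₃ * q₃)]

/-- If `‖x‖ < c` and `c * (‖p‖² + ‖q‖² + ‖p - q‖²) = 2 * det (x, p, q)`, then `p = q = 0`. -/
theorem eq_zero_of_mul_eq_two_mul_det {c x₁ x₂ x₃ p₁ p₂ p₃ q₁ q₂ q₃ : ℝ} (hc : 0 < c)
    (hx : x₁ ^ 2 + x₂ ^ 2 + x₃ ^ 2 < c ^ 2)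
    (h : c * ((p₁ ^ 2 + p₂ ^ 2 + p₃ ^ 2) + (q₁ ^ 2 + q₂ ^ 2 + q₃ ^ 2) +
        ((p₁ - q₁) ^ 2 + (p₂ - q₂) ^ 2 + (p₃ - q₃) ^ 2)) =
      2 * (x₁ * (p₂ * q₃ - p₃ * q₂) + x₂ * (p₃ * q₁ - p₁ * q₃) + x₃ * (p₁ * q₂ - p₂ * q₁))) :
    (p₁ = 0 ∧ p₂ = 0 ∧ p₃ = 0) ∧ q₁ = 0 ∧ q₂ = 0 ∧ q₃ = 0 := by
  have hdet := det_sq_le_mul_mul x₁ x₂ x₃ p₁ p₂ p₃ q₁ q₂ q₃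
  have eq_zero : ∀ {r s t : ℝ}, r ^ 2 + s ^ 2 + t ^ 2 = 0 → r = 0 ∧ s = 0 ∧ t = 0 := by
    intro r s t h
    have hr := sq_nonneg r
    have hs := sq_nonneg s
    have ht := sq_nonneg t
    refine ⟨?_, ?_, ?_⟩ <;> rw [← sq_eq_zero_iff] <;> linarith
  suffices p₁ ^ 2 + p₂ ^ 2 + p₃ ^ 2 = 0 ∧ q₁ ^ 2 + q₂ ^ 2 + q₃ ^ 2 = 0 from
    ⟨eq_zero this.1, eq_zero this.2⟩
  have hV : 0 ≤ x₁ ^ 2 + x₂ ^ 2 + x₃ ^ 2 := by positivity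
  have hP : 0 ≤ p₁ ^ 2 + p₂ ^ 2 + p₃ ^ 2 := by positivity
  have hQ : 0 ≤ q₁ ^ 2 + q₂ ^ 2 + q₃ ^ 2 := by positivity
  have hS : 0 ≤ (p₁ - q₁) ^ 2 + (p₂ - q₂) ^ 2 + (p₃ - q₃) ^ 2 := by positivity
  generalize x₁ ^ 2 + x₂ ^ 2 + x₃ ^ 2 = V, p₁ ^ 2 + p₂ ^ 2 + p₃ ^ 2 = P,
    q₁ ^ 2 + q₂ ^ 2 + q₃ ^ 2 = Q, (p₁ - q₁) ^ 2 + (p₂ - q₂) ^ 2 + (p₃ - q₃) ^ 2 = S,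
    x₁ * (p₂ * q₃ - p₃ * q₂) + x₂ * (p₃ * q₁ - p₁ * q₃) + x₃ * (p₁ * q₂ - p₂ * q₁) = D
    at *
  have hPQ : P + Q = 0 := by
    by_contra hne
    have hpos : 0 < P + Q := lt_of_le_of_ne (by positivity) (Ne.symm hne)
    have h₁ : (c * (P + Q)) ^ 2 ≤ (2 * D) ^ 2 := by
      rw [← h]
      exact pow_le_pow_left₀ (by positivity) (mul_le_mul_of_nonneg_left (by linarith) hc.le) 2
    have h₂ : V * (4 * (P * Q)) ≤ V * (P + Q) ^ 2 :=
      mul_le_mul_of_nonneg_left (by linarith [sq_nonneg (P - Q)]) hV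
    have h₃ : 0 < (c ^ 2 - V) * (P + Q) ^ 2 := mul_pos (by linarith) (by positivity)
    linarith
  exact ⟨by linarith, by linarith⟩

/-- Let `x`, `y`, `z` have the same real part and the same norm as `a`, a quaternion making an angle
less than `π / 4` with the positive real axis. If `x * y * z = a ^ 3`, then `x = y = z = a`. -/
theorem Quaternion.eq_of_mul_mul_eq_cube {a x y z : ℍ[ℝ]} (hpos : 0 < a.re)
    (hlt : a.imI ^ 2 + a.imJ ^ 2 + a.imK ^ 2 < a.re ^ 2)
    (hx : x.re = a.re) (hy : y.re = a.re) (hz : z.re = a.re)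
    (hx' : normSq x = normSq a) (hy' : normSq y = normSq a) (hz' : normSq z = normSq a)
    (h : x * y * z = a ^ 3) : x = a ∧ y = a ∧ z = a := by
  have hre := congrArg QuaternionAlgebra.re h
  have hI := congrArg QuaternionAlgebra.imI h
  have hJ := congrArg QuaternionAlgebra.imJ h
  have hK := congrArg QuaternionAlgebra.imK h
  simp only [pow_succ, pow_zero, one_mul, re_mul, imI_mul, imJ_mul, imK_mul, hx, hy, hz]
    at hre hI hJ hK
  simp only [normSq_def', hx, hy, hz] at hx' hy' hz'
  suffices (x.imI = a.imI ∧ x.imJ = a.imJ ∧ x.imK = a.imK) ∧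
      (y.imI = a.imI ∧ y.imJ = a.imJ ∧ y.imK = a.imK) ∧
      (z.imI = a.imI ∧ z.imJ = a.imJ ∧ z.imK = a.imK) from
    ⟨Quaternion.ext _ _ hx this.1.1 this.1.2.1 this.1.2.2,
      Quaternion.ext _ _ hy this.2.1.1 this.2.1.2.1 this.2.1.2.2,
      Quaternion.ext _ _ hz this.2.2.1 this.2.2.2.1 this.2.2.2.2⟩
  clear h hx hy hz
  generalize a.re = c, a.imI = a₁, a.imJ = a₂, a.imK = a₃, x.imI = x₁, x.imJ = x₂, x.imK = x₃,
    y.imI = y₁, y.imJ = y₂, y.imK = y₃, z.imI = z₁, z.imJ = z₂, z.imK = z₃ at *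
  have hxV : x₁ ^ 2 + x₂ ^ 2 + x₃ ^ 2 = a₁ ^ 2 + a₂ ^ 2 + a₃ ^ 2 := by linarith
  obtain ⟨⟨e₁, e₂, e₃⟩, f₁, f₂, f₃⟩ := eq_zero_of_mul_eq_two_mul_det (p₁ := y₁ - x₁)
    (p₂ := y₂ - x₂) (p₃ := y₃ - x₃) (q₁ := z₁ - x₁) (q₂ := z₂ - x₂) (q₃ := z₃ - x₃)
    hpos (hxV.trans_lt hlt)
    (by linear_combination 2 * hre + 2 * c * hx' + 2 * c * hy' + 2 * c * hz')
  rw [sub_eq_zero] at e₁ e₂ e₃ f₁ f₂ f₃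
  subst e₁ e₂ e₃ f₁ f₂ f₃
  have hc : 3 * c ^ 2 - (a₁ ^ 2 + a₂ ^ 2 + a₃ ^ 2) ≠ 0 := by nlinarith
  have g₁ : z₁ = a₁ := mul_left_cancel₀ hc (by linear_combination hI + z₁ * hxV)
  have g₂ : z₂ = a₂ := mul_left_cancel₀ hc (by linear_combination hJ + z₂ * hxV)
  have g₃ : z₃ = a₃ := mul_left_cancel₀ hc (by linear_combination hK + z₃ * hxV)
  simp [g₁, g₂, g₃]

/-- The standard embedding of the quaternions into the complex `2 × 2` matrices. -/
noncomputable def Quaternion.toComplexMatrix : ℍ[ℝ] →* Matrix (Fin 2) (Fin 2) ℂ where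
  toFun q := !![⟨q.re, q.imI⟩, ⟨q.imJ, q.imK⟩; ⟨-q.imJ, q.imK⟩, ⟨q.re, -q.imI⟩]
  map_one' := by
    ext i j
    fin_cases i <;> fin_cases j <;> simp [Complex.ext_iff]
  map_mul' p q := by
    ext i j
    fin_cases i <;> fin_cases j <;>
      simp [Complex.ext_iff, Matrix.mul_apply, Fin.sum_univ_two] <;> constructor <;> ring

/-- The quaternion `1 + t (Re ζ j + Im ζ k)`. -/
def Quaternion.onePlus (t : ℝ) (ζ : ℂ) : ℍ[ℝ] := ⟨1, 0, t * ζ.re, t * ζ.im⟩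

@[simp] theorem Quaternion.re_onePlus (t : ℝ) (ζ : ℂ) : (onePlus t ζ).re = 1 := rfl

@[simp] theorem Quaternion.imI_onePlus (t : ℝ) (ζ : ℂ) : (onePlus t ζ).imI = 0 := rfl

@[simp] theorem Quaternion.imJ_onePlus (t : ℝ) (ζ : ℂ) : (onePlus t ζ).imJ = t * ζ.re := rfl

@[simp] theorem Quaternion.imK_onePlus (t : ℝ) (ζ : ℂ) : (onePlus t ζ).imK = t * ζ.im := rfl

theorem Quaternion.onePlus_ne_zero (t : ℝ) (ζ : ℂ) : onePlus t ζ ≠ 0 := fun h ↦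
  one_ne_zero (congrArg QuaternionAlgebra.re h)

theorem Quaternion.onePlus_neg (t : ℝ) {ζ : ℂ} (hζ : ‖ζ‖ = 1) :
    onePlus t (-ζ) = ((1 + t ^ 2 : ℝ) : ℍ[ℝ]) * (onePlus t ζ)⁻¹ := by
  have h : ζ.re * ζ.re + ζ.im * ζ.im = 1 := by
    rw [← Complex.normSq_apply, Complex.normSq_eq_norm_sq, hζ, one_pow]
  rw [eq_mul_inv_iff_mul_eq₀ (onePlus_ne_zero t ζ)]
  ext
  · simp only [re_mul, re_onePlus, imI_onePlus, imJ_onePlus, imK_onePlus, re_coe,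
      Complex.neg_re, Complex.neg_im]
    linear_combination t ^ 2 * h
  all_goals
    simp only [imI_mul, imJ_mul, imK_mul, re_onePlus, imI_onePlus, imJ_onePlus, imK_onePlus,
      imI_coe, imJ_coe, imK_coe, Complex.neg_re, Complex.neg_im]
    ring

theorem Quaternion.continuous_onePlus (ζ : ℂ) : Continuous fun t ↦ onePlus t ζ := by
  have h : ∀ t, onePlus t ζ = 1 + t • (onePlus 1 ζ - 1) := fun t ↦ by ext <;> simp
  exact (continuous_const.add (continuous_id.smul continuous_const)).congr fun t ↦ (h t).symm

/-- The image of `Quaternion.onePlus t ζ` under `Quaternion.toComplexMatrix`, as a matrix of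
polynomials in `t`. -/
noncomputable def onePlusMatrix (ζ : ℂ) : Matrix (Fin 2) (Fin 2) ℂ[X] :=
  !![1, C ζ * X; -(C (star ζ) * X), 1]

theorem toComplexMatrix_onePlus (t : ℝ) (ζ : ℂ) :
    toComplexMatrix (onePlus t ζ) = (evalRingHom (t : ℂ)).mapMatrix (onePlusMatrix ζ) := by
  ext i j
  fin_cases i <;> fin_cases j <;>
    simp [toComplexMatrix, onePlusMatrix, Complex.ext_iff, mul_comm (t : ℝ)]

/-- At `t = I` the matrices `onePlusMatrix ζ` have rank one, and a product of them vanishes only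
if two neighbours are `ζ` and `-ζ`. -/
theorem exists_eval_prod_onePlusMatrix_col (ζ : ℂ) (Z : List ℂ) (hZ : ∀ ξ ∈ ζ :: Z, ‖ξ‖ = 1)
    (hc : (ζ :: Z).IsChain fun ξ η ↦ η ≠ -ξ) :
    ∃ c : ℂ, c ≠ 0 ∧
      (evalRingHom Complex.I).mapMatrix (((ζ :: Z).map onePlusMatrix).prod) 0 0 = c ∧
      (evalRingHom Complex.I).mapMatrix (((ζ :: Z).map onePlusMatrix).prod) 1 0 =
        -(Complex.I * star ζ * c) := by
  induction Z generalizing ζ with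
  | nil => exact ⟨1, one_ne_zero, by simp [onePlusMatrix], by simp [onePlusMatrix, mul_comm Complex.I]⟩
  | cons ξ Z ih =>
    rw [List.isChain_cons_cons] at hc
    obtain ⟨c, hc0, h₀, h₁⟩ := ih ξ (fun η hη ↦ hZ η (List.mem_cons_of_mem _ hη)) hc.2
    have hζ : star ζ * ζ = 1 := by
      simp [← Complex.normSq_eq_conj_mul_self, Complex.normSq_eq_norm_sq, hZ ζ (by simp)]
    have hξ : star ξ * ξ = 1 := by
      simp [← Complex.normSq_eq_conj_mul_self, Complex.normSq_eq_norm_sq, hZ ξ (by simp)]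
    have hne : 1 + ζ * star ξ ≠ 0 := fun h ↦ hc.1 (by linear_combination ξ * h - ζ * hξ)
    refine ⟨(1 + ζ * star ξ) * c, mul_ne_zero hne hc0, ?_, ?_⟩
    · rw [List.map_cons, List.prod_cons, map_mul, Matrix.mul_apply, Fin.sum_univ_two, h₀, h₁]
      simp [onePlusMatrix]
      linear_combination -(ζ * (starRingEnd ℂ) ξ * c) * Complex.I_mul_I
    · rw [List.map_cons, List.prod_cons, map_mul, Matrix.mul_apply, Fin.sum_univ_two, h₀, h₁]
      simp only [Complex.star_def] at hζ
      simp [onePlusMatrix]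
      linear_combination (Complex.I * (starRingEnd ℂ) ξ * c) * hζ

/-- The representation of the free group in the quaternions sending the generator `x` to
`1 + t (Re (z x) j + Im (z x) k)`. -/
noncomputable def quaternionRep {α : Type*} (z : α → ℂ) (t : ℝ) : FreeGroup α →* ℍ[ℝ]ˣ :=
  FreeGroup.lift fun x ↦ Units.mk0 (onePlus t (z x)) (onePlus_ne_zero t (z x))

theorem tendsto_quaternionRep {α : Type*} (z : α → ℂ) (g : FreeGroup α) :
    Tendsto (fun t ↦ (quaternionRep z t g : ℍ[ℝ])) (𝓝 0) (𝓝 1) := by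
  induction g using FreeGroup.induction_on with
  | C1 => simp
  | of x =>
    have h := (continuous_onePlus (z x)).tendsto 0
    have h1 : onePlus 0 (z x) = 1 := by ext <;> simp
    simpa [quaternionRep, h1] using h
  | inv_of x h => simpa using h.inv₀ one_ne_zero
  | mul g k hg hk => simpa using hg.mul hk

/-- The parameter in `Quaternion.onePlus` attached to a letter of a free group word. -/
def letterParam {α : Type*} (z : α → ℂ) (x : α × Bool) : ℂ := cond x.2 (z x.1) (-z x.1)

theorem exists_prod_onePlus_eq {α : Type*} {z : α → ℂ} (hz : ∀ x, ‖z x‖ = 1) (t : ℝ)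
    (L : List (α × Bool)) : ∃ r : ℝ, (L.map fun x ↦ onePlus t (letterParam z x)).prod =
      (r : ℍ[ℝ]) * quaternionRep z t (FreeGroup.mk L) := by
  induction L with
  | nil => exact ⟨1, by simp [← FreeGroup.one_eq_mk]⟩
  | cons x L ih =>
    obtain ⟨r, hr⟩ := ih
    have hmk : FreeGroup.mk (x :: L) = FreeGroup.mk [x] * FreeGroup.mk L := by
      rw [FreeGroup.mul_mk, List.singleton_append]
    rw [List.map_cons, List.prod_cons, hr, hmk, map_mul, Units.val_mul]
    obtain ⟨x, _ | _⟩ := x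
    · refine ⟨(1 + t ^ 2) * r, ?_⟩
      have hx : (quaternionRep z t (FreeGroup.mk [(x, false)]) : ℍ[ℝ]) =
          (onePlus t (z x))⁻¹ := by
        simp [quaternionRep]
      rw [hx, letterParam, cond_false, onePlus_neg t (hz x), Quaternion.coe_mul, mul_assoc, mul_assoc,
        ← mul_assoc (onePlus t (z x))⁻¹, ← mul_assoc (r : ℍ[ℝ]), coe_commutes r]
    · refine ⟨r, ?_⟩
      have hx : (quaternionRep z t (FreeGroup.mk [(x, true)]) : ℍ[ℝ]) = onePlus t (z x) := by
        simp [quaternionRep]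
      rw [hx, letterParam, cond_true, ← mul_assoc, ← mul_assoc, coe_commutes r]

theorem exists_unit_complex_injOn {α : Type*} {s : Set α} (hs : s.Countable) :
    ∃ z : α → ℂ, (∀ x, ‖z x‖ = 1) ∧ (∀ x, 0 < (z x).re) ∧ s.InjOn z := by
  obtain ⟨f, hf⟩ := Set.countable_iff_exists_injOn.1 hs
  have hmem : ∀ n : ℕ, 0 < 1 / ((n : ℝ) + 1) ∧ 1 / ((n : ℝ) + 1) ≤ 1 := fun n ↦
    ⟨by positivity, by rw [div_le_one (by positivity)]; linarith [n.cast_nonneg (α := ℝ)]⟩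
  refine ⟨fun x ↦ Complex.exp ((1 / ((f x : ℝ) + 1) : ℝ) * Complex.I),
    fun x ↦ Complex.norm_exp_ofReal_mul_I _, fun x ↦ ?_, fun x hx y hy hxy ↦ hf hx hy ?_⟩
  · rw [Complex.exp_ofReal_mul_I_re]
    have := hmem (f x)
    exact Real.cos_pos_of_mem_Ioo ⟨by linarith [Real.pi_pos], by linarith [Real.pi_gt_three]⟩
  · have h := congrArg Complex.re hxy
    simp only [Complex.exp_ofReal_mul_I_re] at h
    have hx' := hmem (f x)
    have hy' := hmem (f y)
    have h' := Real.injOn_cos ⟨hx'.1.le, by linarith [Real.pi_gt_three]⟩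
      ⟨hy'.1.le, by linarith [Real.pi_gt_three]⟩ h
    rw [one_div, one_div, inv_inj, add_left_inj] at h'
    exact_mod_cast h'

theorem exists_eventually_quaternionRep_ne_one {α : Type*} {g : FreeGroup α} (hg : g ≠ 1) :
    ∃ z : α → ℂ, ∀ᶠ t in 𝓝[≠] 0, quaternionRep z t g ≠ 1 := by
  classical
  obtain ⟨z, hz, hre, hinj⟩ := exists_unit_complex_injOn
    (s := {x | ∃ b, (x, b) ∈ g.toWord})
    ((g.toWord.toFinset.image Prod.fst).finite_toSet.subset (by
      rintro x ⟨b, hb⟩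
      cases b <;> simp [hb])).countable
  refine ⟨z, ?_⟩
  have hchain : (g.toWord.map (letterParam z)).IsChain fun ξ η ↦ η ≠ -ξ := by
    rw [List.isChain_map]
    refine (FreeGroup.isReduced_toWord (x := g)).imp_of_mem_imp ?_
    rintro ⟨x, b⟩ ⟨y, b'⟩ hx hy h heq
    have hxy : z x = z y → x = y := fun e ↦ hinj ⟨b, hx⟩ ⟨b', hy⟩ e
    have hsum : z y ≠ -z x := fun e ↦ by
      have := congrArg Complex.re e
      rw [Complex.neg_re] at this
      linarith [hre x, hre y]
    simp only at h
    cases b <;> cases b' <;> simp only [letterParam, cond_true, cond_false, neg_neg, neg_inj]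
      at heq
    · exact hsum (by linear_combination -heq)
    · exact absurd (h (hxy heq.symm)) (by simp)
    · exact absurd (h (hxy heq.symm)) (by simp)
    · exact hsum heq
  obtain ⟨ζ, Z, hZ⟩ : ∃ ζ Z, g.toWord.map (letterParam z) = ζ :: Z :=
    List.exists_cons_of_ne_nil (by simpa using hg)
  have hnorm : ∀ ξ ∈ ζ :: Z, ‖ξ‖ = 1 := by
    rw [← hZ]
    simp only [List.mem_map]
    rintro _ ⟨⟨x, _ | _⟩, -, rfl⟩ <;> simp [letterParam, hz]
  set p : ℂ[X] := ((ζ :: Z).map onePlusMatrix).prod 1 0 with hp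
  have hp0 : p ≠ 0 := by
    obtain ⟨c, hc, -, h⟩ := exists_eval_prod_onePlusMatrix_col ζ Z hnorm (hZ ▸ hchain)
    have hζ : star ζ ≠ 0 := by
      rw [star_ne_zero, ← norm_ne_zero_iff, hnorm ζ (by simp)]
      exact one_ne_zero
    intro hzero
    rw [RingHom.mapMatrix_apply, Matrix.map_apply, ← hp, hzero, map_zero] at h
    exact neg_ne_zero.2 (mul_ne_zero (mul_ne_zero Complex.I_ne_zero hζ) hc) h.symm
  have hfin : {t : ℝ | p.IsRoot (t : ℂ)}.Finite :=
    (p.finite_setOfPred_isRoot hp0).preimage Complex.ofReal_injective.injOn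
  filter_upwards [nhdsNE_le_cofinite 0 hfin.compl_mem_cofinite] with t ht hone
  apply ht
  obtain ⟨r, hr⟩ := exists_prod_onePlus_eq hz t g.toWord
  rw [FreeGroup.mk_toWord, hone, Units.val_one, mul_one] at hr
  have hmat : toComplexMatrix (r : ℍ[ℝ]) =
      (evalRingHom (t : ℂ)).mapMatrix ((ζ :: Z).map onePlusMatrix).prod := by
    rw [← hr, map_list_prod, map_list_prod, ← hZ]
    simp only [List.map_map]
    congr 2
    ext1 x
    exact toComplexMatrix_onePlus t _
  have h10 := congrFun (congrFun hmat 1) 0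
  rw [RingHom.mapMatrix_apply, Matrix.map_apply, ← hp] at h10
  rw [Set.mem_ofPred_eq, IsRoot.def, ← coe_evalRingHom, ← h10]
  simp [toComplexMatrix, Complex.ext_iff]

theorem Quaternion.re_units_conj (u a : ℍ[ℝ]ˣ) :
    ((u⁻¹ * a * u : ℍ[ℝ]ˣ) : ℍ[ℝ]).re = (a : ℍ[ℝ]).re := by
  have hcomm : ∀ p q : ℍ[ℝ], (p * q).re = (q * p).re := fun p q ↦ by
    simp only [re_mul]
    ring
  rw [Units.val_mul, hcomm, ← Units.val_mul, ← mul_assoc, mul_inv_cancel, one_mul]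

theorem Quaternion.normSq_units_conj (u a : ℍ[ℝ]ˣ) :
    normSq ((u⁻¹ * a * u : ℍ[ℝ]ˣ) : ℍ[ℝ]) = normSq (a : ℍ[ℝ]) := by
  rw [Units.val_mul, map_mul, mul_comm, ← map_mul, ← Units.val_mul, ← mul_assoc, mul_inv_cancel,
    one_mul]

/-- If a product of three conjugates of `a` in a free group equals `a ^ 3`, then each of them is
equal to `a`. -/
theorem FreeGroup.conj_eq_of_conj_prod_eq_cube {α : Type*} {a u₁ u₂ u₃ : FreeGroup α}
    (h : u₁⁻¹ * a * u₁ * (u₂⁻¹ * a * u₂) * (u₃⁻¹ * a * u₃) = a ^ 3) :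
    u₁⁻¹ * a * u₁ = a ∧ u₂⁻¹ * a * u₂ = a ∧ u₃⁻¹ * a * u₃ = a := by
  have key : ∀ z : α → ℂ, ∀ᶠ t in 𝓝[≠] 0,
      quaternionRep z t (u₁⁻¹ * a * u₁) = quaternionRep z t a ∧
      quaternionRep z t (u₂⁻¹ * a * u₂) = quaternionRep z t a ∧
      quaternionRep z t (u₃⁻¹ * a * u₃) = quaternionRep z t a := by
    intro z
    have hopen : IsOpen {q : ℍ[ℝ] | 0 < q.re ∧ q.imI ^ 2 + q.imJ ^ 2 + q.imK ^ 2 < q.re ^ 2} :=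
      (isOpen_lt continuous_const continuous_re).inter
        (isOpen_lt (((continuous_imI.pow 2).add (continuous_imJ.pow 2)).add
          (continuous_imK.pow 2)) (continuous_re.pow 2))
    have hev := (tendsto_quaternionRep z a).eventually (hopen.mem_nhds (by simp))
    filter_upwards [hev.filter_mono nhdsWithin_le_nhds] with t ht
    have hprod := congrArg (fun g ↦ (quaternionRep z t g : ℍ[ℝ])) h
    simp only [_root_.map_mul, _root_.map_pow, _root_.map_inv] at hprod ⊢
    rw [Units.val_mul, Units.val_mul, Units.val_pow_eq_pow_val] at hprod
    simp only [Units.ext_iff]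
    exact eq_of_mul_mul_eq_cube ht.1 ht.2 (re_units_conj _ _) (re_units_conj _ _)
      (re_units_conj _ _) (normSq_units_conj _ _) (normSq_units_conj _ _)
      (normSq_units_conj _ _) hprod
  have detect : ∀ g : FreeGroup α, (∀ z : α → ℂ, ∀ᶠ t in 𝓝[≠] 0,
      quaternionRep z t g = quaternionRep z t a) → g = a := by
    intro g hg
    by_contra hne
    obtain ⟨z, hz⟩ := exists_eventually_quaternionRep_ne_one (mul_inv_eq_one.not.2 hne)
    obtain ⟨t, h₁, h₂⟩ := (hz.and (hg z)).exists
    exact h₁ (by rw [_root_.map_mul, _root_.map_inv, h₂, mul_inv_cancel])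
  exact ⟨detect _ fun z ↦ (key z).mono fun _ ht ↦ ht.1,
    detect _ fun z ↦ (key z).mono fun _ ht ↦ ht.2.1,
    detect _ fun z ↦ (key z).mono fun _ ht ↦ ht.2.2⟩

/-- In a free group, if a product of three conjugates of `a ≠ 1` equals `a³`,
then each conjugate `uᵢ⁻¹ a uᵢ` commutes with `a`. -/
theorem conj_prod_eq_cube_commute {α : Type*} (a u₁ u₂ u₃ : FreeGroup α)
    (ha : a ≠ 1)
    (h : u₁⁻¹ * a * u₁ * (u₂⁻¹ * a * u₂) * (u₃⁻¹ * a * u₃) = a ^ 3) :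
    Commute (u₁⁻¹ * a * u₁) a ∧ Commute (u₂⁻¹ * a * u₂) a ∧
      Commute (u₃⁻¹ * a * u₃) a := by
  obtain ⟨h₁, h₂, h₃⟩ := FreeGroup.conj_eq_of_conj_prod_eq_cube h
  rw [h₁, h₂, h₃]
  exact ⟨Commute.refl a, Commute.refl a, Commute.refl a⟩
end

section
/- Every homomorphism from the genus-3 non-orientable surface group G = ⟨x, y, z | x²y²z²⟩ to a free group factors through a cyclic group: for every free group F and homomorphism φ : G → F, there exist c ∈ F and integers m, n, k with φ(x) = cᵐ, φ(y) = cⁿ, φ(z) = cᵏ and 2(m + n + k) = 0, i.e., m + n + k = 0 (when c has infinite order). -/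
/-- The discrete Heisenberg group of integral upper unitriangular `3 × 3` matrices, with `a` and `b`
the superdiagonal entries and `c` the corner entry. -/
@[ext]
structure Heisenberg where
  a : ℤ
  b : ℤ
  c : ℤ

namespace Heisenberg

instance : Mul Heisenberg := ⟨fun g h => ⟨g.a + h.a, g.b + h.b, g.c + h.c + g.a * h.b⟩⟩

instance : One Heisenberg := ⟨⟨0, 0, 0⟩⟩

instance : Inv Heisenberg := ⟨fun g => ⟨-g.a, -g.b, -g.c + g.a * g.b⟩⟩

@[simp] lemma mul_a (g h : Heisenberg) : (g * h).a = g.a + h.a := rfl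
@[simp] lemma mul_b (g h : Heisenberg) : (g * h).b = g.b + h.b := rfl
@[simp] lemma mul_c (g h : Heisenberg) : (g * h).c = g.c + h.c + g.a * h.b := rfl
@[simp] lemma one_a : (1 : Heisenberg).a = 0 := rfl
@[simp] lemma one_b : (1 : Heisenberg).b = 0 := rfl
@[simp] lemma one_c : (1 : Heisenberg).c = 0 := rfl
@[simp] lemma inv_a (g : Heisenberg) : g⁻¹.a = -g.a := rfl
@[simp] lemma inv_b (g : Heisenberg) : g⁻¹.b = -g.b := rfl
@[simp] lemma inv_c (g : Heisenberg) : g⁻¹.c = -g.c + g.a * g.b := rfl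

instance : Group Heisenberg :=
  Group.ofLeftAxioms
    (fun g h k => by ext <;> simp <;> ring)
    (fun g => by ext <;> simp)
    (fun g => by ext <;> simp)

/-- The determinant of the images of `g` and `h` in the abelianization `ℤ²`. -/
def det (g h : Heisenberg) : ℤ := g.a * h.b - g.b * h.a

lemma two_dvd_det_of_sq_mul_sq_mul_sq_eq_one {x y z : Heisenberg}
    (h : x ^ 2 * y ^ 2 * z ^ 2 = 1) :
    2 ∣ det x y ∧ 2 ∣ det x z ∧ 2 ∣ det y z := by
  have ha := congrArg Heisenberg.a h
  have hb := congrArg Heisenberg.b h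
  have hc := congrArg Heisenberg.c h
  simp only [pow_two, mul_a, mul_b, mul_c, one_a, one_b, one_c] at ha hb hc
  have hza : z.a = -x.a - y.a := by linarith
  have hzb : z.b = -x.b - y.b := by linarith
  have hxy : 2 ∣ det x y := by
    refine ⟨-(x.c + y.c + z.c) + x.a * x.b + y.a * y.b + y.a * x.b, ?_⟩
    rw [hza, hzb] at hc
    unfold det
    linarith
  have hxz : det x z = -det x y := by simp only [det, hza, hzb]; ring
  have hyz : det y z = det x y := by simp only [det, hza, hzb]; ring
  exact ⟨hxy, by rwa [hxz, dvd_neg], by rwa [hyz]⟩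

lemma two_dvd_det_of_mem_closure {s : Set Heisenberg}
    (hs : ∀ g ∈ s, ∀ h ∈ s, 2 ∣ det g h) {g h : Heisenberg}
    (hg : g ∈ Subgroup.closure s) (hh : h ∈ Subgroup.closure s) : 2 ∣ det g h := by
  have mul_left (g₁ g₂ h : Heisenberg) : det (g₁ * g₂) h = det g₁ h + det g₂ h := by
    simp only [det, mul_a, mul_b]; ring
  have mul_right (g h₁ h₂ : Heisenberg) : det g (h₁ * h₂) = det g h₁ + det g h₂ := by
    simp only [det, mul_a, mul_b]; ring
  have inv_left (g h : Heisenberg) : det g⁻¹ h = -det g h := by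
    simp only [det, inv_a, inv_b]; ring
  have inv_right (g h : Heisenberg) : det g h⁻¹ = -det g h := by
    simp only [det, inv_a, inv_b]; ring
  induction hg, hh using Subgroup.closure_induction₂ with
  | mem g h hg hh => exact hs g hg h hh
  | one_left h _ => simp [det]
  | one_right g _ => simp [det]
  | mul_left g₁ g₂ h _ _ _ h₁ h₂ => rw [mul_left]; exact dvd_add h₁ h₂
  | mul_right g h₁ h₂ _ _ _ h₁ h₂ => rw [mul_right]; exact dvd_add h₁ h₂
  | inv_left g h _ _ ih => rw [inv_left]; exact ih.neg_right
  | inv_right g h _ _ ih => rw [inv_right]; exact ih.neg_right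

end Heisenberg

lemma FreeGroup.isCyclic_of_subsingleton (ι : Type*) [Subsingleton ι] :
    IsCyclic (FreeGroup ι) := by
  rcases isEmpty_or_nonempty ι with _ | ⟨⟨i⟩⟩
  · exact _root_.isCyclic_of_subsingleton
  · refine ⟨FreeGroup.of i, fun g => ?_⟩
    change g ∈ Subgroup.zpowers (FreeGroup.of i)
    induction g using FreeGroup.induction_on with
    | C1 => exact one_mem _
    | of j => rw [Subsingleton.elim j i]; exact Subgroup.mem_zpowers _
    | inv_of j ih => exact inv_mem ih
    | mul g h hg hh => exact mul_mem hg hh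

/-- A free group generated by three elements satisfying `x²y²z² = 1` is cyclic. -/
theorem IsFreeGroup.isCyclic_of_sq_mul_sq_mul_sq_eq_one_s17 {G : Type*} [Group G] [IsFreeGroup G]
    {x y z : G} (hgen : Subgroup.closure {x, y, z} = ⊤) (h : x ^ 2 * y ^ 2 * z ^ 2 = 1) :
    IsCyclic G := by
  classical
  suffices Subsingleton (IsFreeGroup.Generators G) by
    have := FreeGroup.isCyclic_of_subsingleton (IsFreeGroup.Generators G)
    exact isCyclic_of_surjective (IsFreeGroup.mulEquiv G) (IsFreeGroup.mulEquiv G).surjective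
  refine ⟨fun i j => by_contra fun hij => ?_⟩
  let f : G →* Heisenberg := IsFreeGroup.lift fun k =>
    if k = i then ⟨1, 0, 0⟩ else if k = j then ⟨0, 1, 0⟩ else 1
  obtain ⟨hxy, hxz, hyz⟩ := Heisenberg.two_dvd_det_of_sq_mul_sq_mul_sq_eq_one
    (x := f x) (y := f y) (z := f z) (by simp only [← map_pow, ← map_mul, h, map_one])
  have det_self (g : Heisenberg) : g.det g = 0 := by simp only [Heisenberg.det]; ring
  have det_swap (g h : Heisenberg) : g.det h = -h.det g := by simp only [Heisenberg.det]; ring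
  have hs : ∀ g ∈ f '' {x, y, z}, ∀ h ∈ f '' {x, y, z}, 2 ∣ Heisenberg.det g h := by
    rintro _ ⟨g, rfl | rfl | rfl, rfl⟩ _ ⟨h, rfl | rfl | rfl, rfl⟩ <;>
      first
        | assumption
        | simp only [det_self, dvd_zero]
        | rw [det_swap, dvd_neg]; assumption
  have hmem (g : G) : f g ∈ Subgroup.closure (f '' {x, y, z}) := by
    rw [← MonoidHom.map_closure, hgen]
    exact Subgroup.mem_map_of_mem f (Subgroup.mem_top g)
  have hdet := Heisenberg.two_dvd_det_of_mem_closure hs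
    (hmem (IsFreeGroup.of i)) (hmem (IsFreeGroup.of j))
  simp [f, IsFreeGroup.lift_of, Heisenberg.det, Ne.symm hij] at hdet

/-- Lyndon's theorem, in cyclic form: solutions of `x²y²z² = 1` in a free group are powers of a
common element. -/
theorem IsFreeGroup.exists_zpow_of_sq_mul_sq_mul_sq_eq_one {F : Type*} [Group F] [IsFreeGroup F]
    {x y z : F} (h : x ^ 2 * y ^ 2 * z ^ 2 = 1) :
    ∃ (c : F) (m n k : ℤ), x = c ^ m ∧ y = c ^ n ∧ z = c ^ k := by
  set H := Subgroup.closure {x, y, z}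
  have hx : x ∈ H := Subgroup.subset_closure (by simp)
  have hy : y ∈ H := Subgroup.subset_closure (by simp)
  have hz : z ∈ H := Subgroup.subset_closure (by simp)
  have hgen : Subgroup.closure {(⟨x, hx⟩ : H), ⟨y, hy⟩, ⟨z, hz⟩} = ⊤ := by
    rw [← Subgroup.closure_closure_coe_preimage (k := {x, y, z})]
    congr 1
    ext g
    simp [Subtype.ext_iff]
  obtain ⟨c, hc⟩ := (IsFreeGroup.isCyclic_of_sq_mul_sq_mul_sq_eq_one_s17 hgen
    (Subtype.ext h)).exists_generator
  obtain ⟨m, hm⟩ := hc ⟨x, hx⟩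
  obtain ⟨n, hn⟩ := hc ⟨y, hy⟩
  obtain ⟨k, hk⟩ := hc ⟨z, hz⟩
  exact ⟨c, m, n, k, (congrArg Subtype.val hm).symm, (congrArg Subtype.val hn).symm,
    (congrArg Subtype.val hk).symm⟩

/-- Every homomorphism from `G = ⟨x, y, z ∣ x²y²z² = 1⟩` to a free group factors
through a cyclic group: the images of `x, y, z` are powers `cᵐ, cⁿ, cᵏ` of a
common element `c` with `c^(2(m+n+k)) = 1`, and `m + n + k = 0` whenever
`c ≠ 1`. -/
theorem surfaceGroup_hom_factors_through_cyclic (β : Type)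
    (φ : SurfaceGroup →* FreeGroup β) :
    ∃ (c : FreeGroup β) (m n k : ℤ),
      φ (PresentedGroup.of (rels := surfaceRels) 0) = c ^ m ∧
      φ (PresentedGroup.of (rels := surfaceRels) 1) = c ^ n ∧
      φ (PresentedGroup.of (rels := surfaceRels) 2) = c ^ k ∧
      c ^ (2 * (m + n + k)) = 1 ∧
      (c ≠ 1 → m + n + k = 0) := by
  have hrel : φ (PresentedGroup.of 0) ^ 2 * φ (PresentedGroup.of 1) ^ 2 *
      φ (PresentedGroup.of 2) ^ 2 = 1 := by
    have h : PresentedGroup.mk surfaceRels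
        (FreeGroup.of 0 ^ 2 * FreeGroup.of 1 ^ 2 * FreeGroup.of 2 ^ 2) = 1 :=
      PresentedGroup.one_of_mem rfl
    simpa only [PresentedGroup.of, map_mul, map_pow, map_one] using congrArg φ h
  obtain ⟨c, m, n, k, hx, hy, hz⟩ := IsFreeGroup.exists_zpow_of_sq_mul_sq_mul_sq_eq_one hrel
  have hc : c ^ (2 * (m + n + k)) = 1 := by
    rw [hx, hy, hz] at hrel
    rw [← hrel]
    group
  refine ⟨c, m, n, k, hx, hy, hz, hc, fun hc1 => ?_⟩
  have := (IsMulTorsionFree.zpow_eq_one_iff_right hc1).mp hc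
  lia
end
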